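/- Let E be a finite homogeneous effect algebra such that S(E) = {0, 1}, and let a be an atom of E. If n ≥ 1 and n·a is well defined, then n·a = 1 or n·a ∈ [a, a']. -/

import Mathlib

namespace EffectAlgebraPaper

/-- An effect algebra: a set with 0, 1 and a partially defined sum `add`,
whose domain is the relation `Orth` (written `a ⊥ b` in the paper). -/
class EffectAlgebra (E : Type*) where
  zero : E
  one : E
  /-- `Orth a b` means `a ⊕ b` is defined. -/
  Orth : E → E → Prop
  /-- The sum `a ⊕ b`, meaningful only when `Orth a b`. -/
  add : E → E → E
  orth_comm : ∀ a b : E, Orth a b → Orth b a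
  add_comm : ∀ a b : E, Orth a b → add a b = add b a
  assoc : ∀ a b c : E, Orth b c → Orth a (add b c) →
    Orth a b ∧ Orth (add a b) c ∧ add a (add b c) = add (add a b) c
  compl_exists : ∀ a : E, ∃! b : E, Orth a b ∧ add a b = one
  orth_one : ∀ a : E, Orth a one → a = zero

namespace EffectAlgebra

variable {E : Type*} [EffectAlgebra E]

/-- The orthosupplement `a'`. -/
noncomputable def compl (a : E) : E := (compl_exists a).exists.choose

/-- The effect-algebra partial order: `a ≤ b` iff `a ⊕ c = b` for some `c`. -/
def le (a b : E) : Prop := ∃ c : E, Orth a c ∧ add a c = b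

/-- The interval `[x, y] = {z : x ≤ z ≤ y}`. -/
def Interval (x y : E) : Set E := { z : E | le x z ∧ le z y }

/-- An atom: a minimal nonzero element. -/
def Atom (a : E) : Prop := a ≠ zero ∧ ∀ b : E, b ≠ zero → le b a → b = a

/-- A sharp element: the only common lower bound of `x` and `x'` is `0`. -/
def Sharp (x : E) : Prop := ∀ b : E, le b x → le b (compl x) → b = zero

/-- `S(E)`, the set of sharp elements. -/
def sharpSet (E : Type*) [EffectAlgebra E] : Set E := { x : E | Sharp x }

/-- Homogeneity: `u ≤ v₁ ⊕ v₂ ≤ u'` implies `u = u₁ ⊕ u₂` with `u₁ ≤ v₁`, `u₂ ≤ v₂`. -/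
def Homogeneous (E : Type*) [EffectAlgebra E] : Prop :=
  ∀ u v₁ v₂ : E, Orth v₁ v₂ → le u (add v₁ v₂) → le (add v₁ v₂) (compl u) →
    ∃ u₁ u₂ : E, le u₁ v₁ ∧ le u₂ v₂ ∧ Orth u₁ u₂ ∧ add u₁ u₂ = u

/-- `nmul n a` is the iterated sum `n·a = a ⊕ ⋯ ⊕ a` (`n` times), with `0·a = 0`;
it is meaningful only when `nmulDef n a` holds. -/
def nmul : ℕ → E → E
  | 0, _ => zero
  | n + 1, a => add (nmul n a) a

/-- `nmulDef n a` says the iterated sum `n·a` is well defined. -/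
def nmulDef : ℕ → E → Prop
  | 0, _ => True
  | n + 1, a => nmulDef n a ∧ Orth (nmul n a) a

end EffectAlgebra

open EffectAlgebra

namespace EffectAlgebra

variable {E : Type*} [EffectAlgebra E]

theorem orth_compl (a : E) : Orth a (compl a) := (compl_exists a).exists.choose_spec.1

theorem add_compl (a : E) : add a (compl a) = one := (compl_exists a).exists.choose_spec.2

theorem eq_compl {a b : E} (h : Orth a b) (h1 : add a b = one) : b = compl a :=
  (compl_exists a).unique ⟨h, h1⟩ ⟨orth_compl a, add_compl a⟩

theorem compl_one : compl (one : E) = zero := orth_one _ (orth_comm _ _ (orth_compl one))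

theorem orth_zero_left_and_zero_add (a : E) : Orth zero a ∧ add zero a = a := by
  have h0 : Orth (one : E) zero := compl_one (E := E) ▸ orth_compl one
  have h1 : add (one : E) zero = one := compl_one (E := E) ▸ add_compl one
  have h0' : Orth zero (add a (compl a)) := by
    rw [add_compl]; exact orth_comm _ _ h0
  obtain ⟨p, q, r⟩ := assoc _ _ _ (orth_compl a) h0'
  rw [add_compl, ← add_comm _ _ h0, h1, add_comm _ _ q] at r
  refine ⟨p, ?_⟩
  rw [eq_compl (orth_comm _ _ q) r.symm]
  exact (eq_compl (orth_comm _ _ (orth_compl a))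
    ((add_comm _ _ (orth_compl a)).symm.trans (add_compl a))).symm

theorem le_add_left {a b : E} (h : Orth a b) : le b (add a b) :=
  ⟨a, orth_comm _ _ h, (add_comm _ _ h).symm⟩

theorem le_add_right {a b : E} (h : Orth a b) : le a (add a b) := ⟨b, h, rfl⟩

theorem le_trans {a b c : E} (hab : le a b) (hbc : le b c) : le a c := by
  obtain ⟨x, hx, rfl⟩ := hab
  obtain ⟨y, hy, rfl⟩ := hbc
  obtain ⟨-, q, r⟩ := assoc y x a (orth_comm _ _ hx)
    (add_comm _ _ hx ▸ orth_comm _ _ hy)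
  refine ⟨add y x, orth_comm _ _ q, ?_⟩
  rw [add_comm _ _ (orth_comm _ _ q), ← r, add_comm _ _ hy, add_comm _ _ hx]

theorem eq_zero_of_le_zero {a : E} (h : le a zero) : a = zero := by
  obtain ⟨c, hc, h⟩ := h
  have h0 := orth_zero_left_and_zero_add (compl (zero : E))
  have h1 : compl (zero : E) = one := by rw [← h0.2, add_compl]
  refine orth_one _ (orth_comm _ _ (assoc one a c hc ?_).1)
  rw [h, ← h1]
  exact orth_comm _ _ (orth_compl zero)

theorem le_compl_iff_orth {a b : E} : le a (compl b) ↔ Orth a b := by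
  constructor
  · rintro ⟨c, hc, h⟩
    exact orth_comm _ _ (assoc b a c hc (h ▸ orth_compl b)).1
  · intro h
    have hc := orth_comm _ _ (orth_compl (add a b))
    obtain ⟨p, q, r⟩ := assoc _ a b h hc
    rw [← add_comm _ _ (orth_compl (add a b)), add_compl, add_comm _ _ q] at r
    exact eq_compl (orth_comm _ _ q) r.symm ▸ le_add_left p

/-- In a homogeneous effect algebra, a nonzero `b` with `b ≤ n·a ≤ b'` lies above the atom `a`. -/
theorem Atom.le_of_le_nmul {a b : E} (hhom : Homogeneous E) (ha : Atom a) (hb : b ≠ zero) {n : ℕ}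
    (hdef : nmulDef n a) (hle : le b (nmul n a)) (hle' : le (nmul n a) (compl b)) : le a b := by
  induction n with
  | zero => exact absurd (eq_zero_of_le_zero hle) hb
  | succ k ih =>
    obtain ⟨hk, horth⟩ := hdef
    obtain ⟨u, v, hu, hv, huv, hb'⟩ := hhom b _ _ horth hle hle'
    by_cases hv0 : v = zero
    · subst hv0
      rw [add_comm _ _ huv, (orth_zero_left_and_zero_add u).2] at hb'
      exact ih hk (hb' ▸ hu) (le_trans (le_add_right horth) hle')
    · exact ha.2 v hv0 hv ▸ hb' ▸ le_add_left huv

theorem Atom.sharp_nmul {a : E} (hhom : Homogeneous E) (ha : Atom a) {n : ℕ}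
    (hdef : nmulDef n a) (h : ¬ Orth (nmul n a) a) : Sharp (nmul n a) := by
  intro b hb hb'
  by_contra hb0
  have hle := le_compl_iff_orth.2 (orth_comm _ _ (le_compl_iff_orth.1 hb'))
  exact h (orth_comm _ _ (le_compl_iff_orth.1
    (le_trans (ha.le_of_le_nmul hhom hb0 hdef hb hle) hb')))

end EffectAlgebra

/-- Lemma 6 (lem31): in a finite homogeneous effect algebra with `S(E) = {0, 1}`,
if `a` is an atom, `n ≥ 1` and `n·a` is well defined, then `n·a = 1` or `n·a ∈ [a, a']`. -/
theorem stmt5 {E : Type*} [EffectAlgebra E] [Finite E] (hhom : Homogeneous E)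
    (hS : sharpSet E = {zero, one})
    (a : E) (ha : Atom a) (n : ℕ) (hn : 1 ≤ n) (hdef : nmulDef n a) :
    nmul n a = one ∨ nmul n a ∈ Interval a (compl a) := by
  obtain ⟨k, rfl⟩ := Nat.exists_eq_add_of_le' hn
  have hle : le a (nmul (k + 1) a) := le_add_left hdef.2
  by_cases h : Orth (nmul (k + 1) a) a
  · exact Or.inr ⟨hle, le_compl_iff_orth.2 h⟩
  · have hmem : nmul (k + 1) a ∈ sharpSet E := ha.sharp_nmul hhom hdef h
    rw [hS] at hmem
    rcases hmem with h0 | h1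
    · exact absurd (eq_zero_of_le_zero (h0 ▸ hle)) ha.1
    · exact Or.inl h1

end EffectAlgebraPaper
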